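/- There is an absolute constant c > 0 such that for every number field K of degree d > 1 over ℚ and every positive integer ℓ with 2ℓ ≥ d, one has M_{K,ℓ} ≥ c · η(K)^{−1/ℓ}. -/

import Mathlib

open NumberField Polynomial

/-- The denominator ideal of `α ∈ K`: the set of `x ∈ 𝓞 K` with `x·α ∈ 𝓞 K`.
Its absolute norm is the non-archimedean part `∏_v max(1,|α|_v)^{d_v}` of the height. -/
noncomputable def denIdeal (K : Type*) [Field K] [NumberField K] (α : K) : Ideal (𝓞 K) where
  carrier := {x : 𝓞 K | ∃ y : 𝓞 K, (x : K) * α = (y : K)}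
  zero_mem' := ⟨0, by simp⟩
  add_mem' := by
    rintro a b ⟨ya, ha⟩ ⟨yb, hb⟩
    exact ⟨ya + yb, by push_cast; rw [add_mul, ha, hb]⟩
  smul_mem' := by
    rintro c x ⟨y, hy⟩
    exact ⟨c * y, by rw [smul_eq_mul]; push_cast; rw [mul_assoc, hy]⟩

/-- The relative multiplicative Weil height `H_K(α) = ∏_{v ∈ M_K} max(1,|α|_v)^{d_v}`. -/
noncomputable def heightK (K : Type*) [Field K] [NumberField K] (α : K) : ℝ :=
  (Ideal.absNorm (denIdeal K α) : ℝ) * ∏ w : InfinitePlace K, max 1 (w α) ^ w.mult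

/-- `N'_K(X)`: the number of `α ∈ K` with `ℚ(α) = K` and `H_K(α) < X`. -/
noncomputable def NprimeK (K : Type*) [Field K] [NumberField K] (X : ℝ) : ℕ :=
  Nat.card {α : K // IntermediateField.adjoin ℚ {α} = ⊤ ∧ heightK K α < X}

/-- `M_{K,ℓ} = inf_{X > 0} X^{-1/ℓ}(1 + N'_K(X))`. -/
noncomputable def MKl (K : Type*) [Field K] [NumberField K] (ℓ : ℕ) : ℝ :=
  ⨅ X : {X : ℝ // 0 < X}, (X : ℝ) ^ (-(1:ℝ)/ℓ) * (1 + (NprimeK K X : ℝ))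

/-- `η(K)`: the minimal height of a primitive element of `K`. -/
noncomputable def etaK (K : Type*) [Field K] [NumberField K] : ℝ :=
  sInf {x : ℝ | ∃ α : K, IntermediateField.adjoin ℚ {α} = ⊤ ∧ heightK K α = x}

/-- `D_K`: the absolute value of the discriminant. -/
noncomputable def DK (K : Type*) [Field K] [NumberField K] : ℕ :=
  (NumberField.discr K).natAbs


theorem denIdeal_ne_bot (K : Type*) [Field K] [NumberField K] (α : K) : denIdeal K α ≠ ⊥ := by
  obtain ⟨x, y, hy, rfl⟩ := IsFractionRing.div_surjective (A := 𝓞 K) α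
  have hy0 : y ≠ 0 := nonZeroDivisors.ne_zero hy
  have hyK : (algebraMap (𝓞 K) K) y ≠ 0 := by simpa using hy0
  refine (Submodule.ne_bot_iff _).2 ⟨y, ⟨x, ?_⟩, hy0⟩
  exact mul_div_cancel₀ _ hyK

theorem absNorm_denIdeal_pos (K : Type*) [Field K] [NumberField K] (α : K) :
    0 < Ideal.absNorm (denIdeal K α) :=
  Nat.pos_of_ne_zero fun h => denIdeal_ne_bot K α (Ideal.absNorm_eq_zero_iff.1 h)

theorem one_le_max_one_pow (x : ℝ) (n : ℕ) : 1 ≤ max 1 x ^ n :=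
  one_le_pow₀ (le_max_left _ _)

theorem one_le_archimedean_height (K : Type*) [Field K] [NumberField K] (α : K) :
    1 ≤ ∏ w : InfinitePlace K, max 1 (w α) ^ w.mult :=
  Finset.one_le_prod fun w _ => one_le_max_one_pow (w α) w.mult

theorem absNorm_denIdeal_le_heightK (K : Type*) [Field K] [NumberField K] (α : K) :
    (Ideal.absNorm (denIdeal K α) : ℝ) ≤ heightK K α :=
  le_mul_of_one_le_right (Nat.cast_nonneg _) (one_le_archimedean_height K α)

theorem one_le_heightK (K : Type*) [Field K] [NumberField K] (α : K) : 1 ≤ heightK K α :=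
  (Nat.one_le_cast.2 (absNorm_denIdeal_pos K α)).trans (absNorm_denIdeal_le_heightK K α)

theorem infinitePlace_le_heightK (K : Type*) [Field K] [NumberField K] (α : K)
    (w : InfinitePlace K) : w α ≤ heightK K α := by
  classical
  calc w α ≤ max 1 (w α) := le_max_right _ _
    _ ≤ max 1 (w α) ^ w.mult := le_self_pow₀ (le_max_left _ _) w.mult_ne_zero
    _ ≤ ∏ v : InfinitePlace K, max 1 (v α) ^ v.mult := by
      rw [← Finset.mul_prod_erase _ _ (Finset.mem_univ w)]
      exact le_mul_of_one_le_right (zero_le_one.trans (one_le_max_one_pow _ _))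
        (Finset.one_le_prod fun v _ => one_le_max_one_pow (v α) v.mult)
    _ ≤ heightK K α :=
      le_mul_of_one_le_left (zero_le_one.trans (one_le_archimedean_height K α))
        (Nat.one_le_cast.2 (absNorm_denIdeal_pos K α))

/-- Northcott's theorem for the elements of a fixed number field. -/
theorem finite_setOf_heightK_lt (K : Type*) [Field K] [NumberField K] (X : ℝ) :
    {α : K | heightK K α < X}.Finite := by
  have hfin (N : ℕ) := Embeddings.finite_of_norm_le K ℂ ((N : ℝ) * X)
  refine ((Set.finite_Iic ⌊X⌋₊).biUnion fun N _ =>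
    (hfin N).image fun x : K => x / (N : K)).subset ?_
  intro α hα
  have hα' : heightK K α < X := hα
  set N := Ideal.absNorm (denIdeal K α) with hN
  have hN0 : (N : K) ≠ 0 := Nat.cast_ne_zero.2 (absNorm_denIdeal_pos K α).ne'
  obtain ⟨y, hy⟩ : (N : 𝓞 K) ∈ denIdeal K α := Ideal.absNorm_mem _
  have hy' : (N : K) * α = (y : K) := by simpa using hy
  refine Set.mem_biUnion (x := N) ?_ ⟨(N : K) * α, ⟨?_, fun φ => ?_⟩, ?_⟩
  · exact Nat.le_floor ((absNorm_denIdeal_le_heightK K α).trans hα'.le)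
  · rw [hy']
    exact y.isIntegral_coe
  · rw [map_mul, norm_mul, map_natCast, Complex.norm_natCast]
    exact mul_le_mul_of_nonneg_left
      ((infinitePlace_le_heightK K α (InfinitePlace.mk φ)).trans hα'.le) (Nat.cast_nonneg _)
  · exact mul_div_cancel_left₀ _ hN0

theorem denIdeal_le_denIdeal_natCast_mul_add (K : Type*) [Field K] [NumberField K] (α : K)
    (a b : ℕ) : denIdeal K α ≤ denIdeal K ((a : K) * α + b) := by
  rintro x ⟨y, hy⟩
  refine ⟨a * y + x * b, ?_⟩
  push_cast
  have hy' : (x : K) * α = (y : K) := hy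
  linear_combination (a : K) * hy'

theorem heightK_natCast_mul_add_le (K : Type*) [Field K] [NumberField K] (α : K) {a b : ℕ}
    (hab : 1 ≤ a + b) :
    heightK K ((a : K) * α + b) ≤ ((a + b : ℕ) : ℝ) ^ Module.finrank ℚ K * heightK K α := by
  have hden : Ideal.absNorm (denIdeal K ((a : K) * α + b)) ≤ Ideal.absNorm (denIdeal K α) :=
    Nat.le_of_dvd (absNorm_denIdeal_pos K α)
      (Ideal.absNorm_dvd_absNorm_of_le (denIdeal_le_denIdeal_natCast_mul_add K α a b))
  have hplace (w : InfinitePlace K) :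
      max 1 (w ((a : K) * α + b)) ≤ ((a + b : ℕ) : ℝ) * max 1 (w α) := by
    have hab' : (1 : ℝ) ≤ ((a + b : ℕ) : ℝ) := Nat.one_le_cast.2 hab
    refine max_le (one_le_mul_of_one_le_of_one_le hab' (le_max_left _ _)) ?_
    have hnat (n : ℕ) : w (n : K) = n := by
      rw [← InfinitePlace.norm_embedding_eq, map_natCast, Complex.norm_natCast]
    calc w ((a : K) * α + b) ≤ w ((a : K) * α) + w (b : K) := w.1.add_le _ _
      _ = a * w α + b * 1 := by rw [map_mul, hnat, hnat, mul_one]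
      _ ≤ a * max 1 (w α) + b * max 1 (w α) := by
        gcongr
        · exact le_max_right _ _
        · exact le_max_left _ _
      _ = ((a + b : ℕ) : ℝ) * max 1 (w α) := by push_cast; ring
  have harch : ∏ w : InfinitePlace K, max 1 (w ((a : K) * α + b)) ^ w.mult ≤
      ((a + b : ℕ) : ℝ) ^ Module.finrank ℚ K * ∏ w : InfinitePlace K, max 1 (w α) ^ w.mult := by
    rw [← InfinitePlace.sum_mult_eq, ← Finset.prod_pow_eq_pow_sum, ← Finset.prod_mul_distrib]
    refine Finset.prod_le_prod (fun w _ => zero_le_one.trans (one_le_max_one_pow _ _))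
      fun w _ => ?_
    rw [← mul_pow]
    exact pow_le_pow_left₀ (zero_le_one.trans (le_max_left _ _)) (hplace w) _
  calc heightK K ((a : K) * α + b)
      ≤ (Ideal.absNorm (denIdeal K α) : ℝ) * (((a + b : ℕ) : ℝ) ^ Module.finrank ℚ K *
          ∏ w : InfinitePlace K, max 1 (w α) ^ w.mult) :=
        mul_le_mul (Nat.cast_le.2 hden) harch
          (zero_le_one.trans (one_le_archimedean_height K _)) (Nat.cast_nonneg _)
    _ = ((a + b : ℕ) : ℝ) ^ Module.finrank ℚ K * heightK K α := by rw [heightK]; ring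

theorem adjoin_natCast_mul_add_eq_top {K : Type*} [Field K] [CharZero K] {α : K}
    (hα : IntermediateField.adjoin ℚ {α} = ⊤) {a : ℕ} (ha : a ≠ 0) (b : ℕ) :
    IntermediateField.adjoin ℚ {(a : K) * α + b} = ⊤ := by
  rw [eq_top_iff, ← hα, IntermediateField.adjoin_simple_le_iff]
  have ha' : (a : K) ≠ 0 := Nat.cast_ne_zero.2 ha
  have h : ((a : K) * α + b - b) / a = α := by
    rw [add_sub_cancel_right, mul_div_cancel_left₀ _ ha']
  have hmem := IntermediateField.mem_adjoin_simple_self ℚ ((a : K) * α + b)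
  have hdiv := div_mem (sub_mem hmem (natCast_mem _ b)) (natCast_mem _ a)
  rwa [h] at hdiv

/-- A generator of a field of degree greater than one is irrational. -/
theorem natCast_mul_add_injective {K : Type*} [Field K] [CharZero K] {α : K}
    (hα : IntermediateField.adjoin ℚ {α} = ⊤) (hd : 1 < Module.finrank ℚ K) :
    Function.Injective fun p : ℕ × ℕ => (p.1 : K) * α + p.2 := by
  rintro ⟨a, b⟩ ⟨a', b'⟩ h
  have h' : (a : K) * α + b = a' * α + b' := h
  have haa : a = a' := by
    by_contra hne
    have hsub : (a : K) - a' ≠ 0 := sub_ne_zero.2 (Nat.cast_injective.ne hne)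
    have hrat : α = ((b' : K) - b) / (a - a') := by
      rw [eq_div_iff hsub]
      linear_combination h'
    have hmem : α ∈ (⊥ : IntermediateField ℚ K) := by
      rw [hrat]
      exact div_mem (sub_mem (natCast_mem _ _) (natCast_mem _ _))
        (sub_mem (natCast_mem _ _) (natCast_mem _ _))
    have hbt : (⊥ : IntermediateField ℚ K) = ⊤ :=
      (IntermediateField.adjoin_simple_eq_bot_iff.2 hmem).symm.trans hα
    have := IntermediateField.finrank_bot (F := ℚ) (E := K)
    rw [hbt, IntermediateField.finrank_top'] at this
    omega
  subst haa
  have : (b : K) = b' := by linear_combination h'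
  rw [Nat.cast_injective this]

theorem sq_le_NprimeK {K : Type*} [Field K] [NumberField K] {α : K}
    (hα : IntermediateField.adjoin ℚ {α} = ⊤) (hd : 1 < Module.finrank ℚ K) {m : ℕ} {X t : ℝ}
    (hm : 2 * (m : ℝ) - 1 < t) (htX : t ^ Module.finrank ℚ K * heightK K α ≤ X) :
    m ^ 2 ≤ NprimeK K X := by
  have hfin : Finite {β : K // IntermediateField.adjoin ℚ {β} = ⊤ ∧ heightK K β < X} :=
    ((finite_setOf_heightK_lt K X).subset fun _ h => h.2).to_subtype
  have hheight (p : Fin m × Fin m) :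
      heightK K (((p.1 + 1 : ℕ) : K) * α + (p.2 : ℕ)) < X := by
    have hsum : (p.1 + 1 : ℕ) + (p.2 : ℕ) + 1 ≤ 2 * m := by omega
    have hlt : (((p.1 + 1 : ℕ) + (p.2 : ℕ) : ℕ) : ℝ) < t := by
      have : ((((p.1 + 1 : ℕ) + (p.2 : ℕ) + 1 : ℕ)) : ℝ) ≤ ((2 * m : ℕ) : ℝ) :=
        Nat.cast_le.2 hsum
      push_cast at this ⊢
      linarith
    refine (heightK_natCast_mul_add_le K α (by omega)).trans_lt (lt_of_lt_of_le ?_ htX)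
    exact mul_lt_mul_of_pos_right (pow_lt_pow_left₀ hlt (Nat.cast_nonneg _) (by omega))
      (zero_lt_one.trans_le (one_le_heightK K α))
  let f (p : Fin m × Fin m) : {β : K // IntermediateField.adjoin ℚ {β} = ⊤ ∧ heightK K β < X} :=
    ⟨((p.1 + 1 : ℕ) : K) * α + (p.2 : ℕ),
      adjoin_natCast_mul_add_eq_top hα (Nat.succ_ne_zero _) _, hheight p⟩
  have hf : Function.Injective f := by
    intro p q hpq
    have h := @natCast_mul_add_injective K _ _ α hα hd (p.1 + 1, p.2) (q.1 + 1, q.2)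
      (congrArg Subtype.val hpq)
    simp only [Prod.mk.injEq, Nat.add_right_cancel_iff] at h
    exact Prod.ext (Fin.ext h.1) (Fin.ext h.2)
  calc m ^ 2 = Nat.card (Fin m × Fin m) := by simp [sq]
    _ ≤ NprimeK K X := Nat.card_le_card_of_injective f hf

theorem rpow_div_heightK_le_NprimeK {K : Type*} [Field K] [NumberField K] {α : K}
    (hα : IntermediateField.adjoin ℚ {α} = ⊤) (hd : 1 < Module.finrank ℚ K) {ℓ : ℕ} (hℓ : 0 < ℓ)
    (hdℓ : Module.finrank ℚ K ≤ 2 * ℓ) {X : ℝ} (hX : 0 < X) :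
    (1 / 8 : ℝ) * (X / heightK K α) ^ (1 / (ℓ : ℝ)) ≤ 1 + NprimeK K X := by
  have hH : 0 < heightK K α := zero_lt_one.trans_le (one_le_heightK K α)
  have hℓ' : (0 : ℝ) < ℓ := Nat.cast_pos.2 hℓ
  rcases le_total (X / heightK K α) 1 with hle | hge
  · have h1 : (X / heightK K α) ^ (1 / (ℓ : ℝ)) ≤ 1 :=
      Real.rpow_le_one (by positivity) hle (by positivity)
    have h2 : (0 : ℝ) ≤ NprimeK K X := Nat.cast_nonneg _
    linarith
  · set d := Module.finrank ℚ K
    set t := (X / heightK K α) ^ (1 / (d : ℝ)) with ht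
    have hd0 : (0 : ℝ) < d := Nat.cast_pos.2 (by omega)
    have ht1 : 1 ≤ t := Real.one_le_rpow hge (by positivity)
    have htd : t ^ d = X / heightK K α := by
      rw [ht, one_div, Real.rpow_inv_natCast_pow (by positivity) (by omega)]
    have hexp : (X / heightK K α) ^ (1 / (ℓ : ℝ)) ≤ t ^ 2 := by
      rw [← htd, ← Real.rpow_natCast, ← Real.rpow_mul (by positivity), ← Real.rpow_natCast]
      refine Real.rpow_le_rpow_of_exponent_le ht1 ?_
      rw [mul_one_div, div_le_iff₀ hℓ']
      exact_mod_cast hdℓ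
    have hm1 : 2 * (⌈(t - 1) / 2⌉₊ : ℝ) - 1 < t := by
      have := Nat.ceil_lt_add_one (a := (t - 1) / 2) (by linarith)
      linarith
    have hm2 : (t - 1) / 2 ≤ (⌈(t - 1) / 2⌉₊ : ℝ) := Nat.le_ceil _
    have hcount : ((⌈(t - 1) / 2⌉₊ : ℕ) : ℝ) ^ 2 ≤ NprimeK K X := by
      exact_mod_cast sq_le_NprimeK hα hd hm1 (by rw [htd, div_mul_cancel₀ _ hH.ne'])
    nlinarith [sq_nonneg ((⌈(t - 1) / 2⌉₊ : ℝ) - 1)]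

theorem exists_heightK_lt_two_mul_etaK (K : Type*) [Field K] [NumberField K] :
    ∃ α : K, IntermediateField.adjoin ℚ {α} = ⊤ ∧ heightK K α < 2 * etaK K := by
  obtain ⟨β, hβ⟩ := Field.exists_primitive_element ℚ K
  have hne : {x : ℝ | ∃ α : K, IntermediateField.adjoin ℚ {α} = ⊤ ∧ heightK K α = x}.Nonempty :=
    ⟨_, β, hβ, rfl⟩
  have h1 : 1 ≤ etaK K := le_csInf hne fun x ⟨α, _, hx⟩ => hx ▸ one_le_heightK K α
  obtain ⟨_, ⟨α, hα, rfl⟩, hlt⟩ := exists_lt_of_csInf_lt hne (show etaK K < 2 * etaK K by linarith)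
  exact ⟨α, hα, hlt⟩

/-- `M_{K,ℓ} ≫ η(K)^{-1/ℓ}` with an absolute implied constant, for `2ℓ ≥ d`. -/
theorem MKl_lower :
    ∃ c : ℝ, 0 < c ∧
      ∀ (K : Type) (_ : Field K) (_ : NumberField K) (d ℓ : ℕ),
        Module.finrank ℚ K = d → 1 < d → 0 < ℓ → d ≤ 2 * ℓ →
        c * etaK K ^ (-(1 : ℝ) / (ℓ : ℝ)) ≤ MKl K ℓ := by
  refine ⟨1 / 16, by norm_num, ?_⟩
  rintro K _ _ d ℓ rfl hd hℓ hdℓ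
  obtain ⟨α, hα, hlt⟩ := exists_heightK_lt_two_mul_etaK K
  have hH : 0 < heightK K α := zero_lt_one.trans_le (one_le_heightK K α)
  have heta : 0 < etaK K := by linarith
  have hℓ1 : (1 : ℝ) ≤ ℓ := Nat.one_le_cast.2 hℓ
  have : Nonempty {X : ℝ // 0 < X} := ⟨⟨1, one_pos⟩⟩
  refine le_ciInf fun ⟨X, hX⟩ => ?_
  have hneg : -(1 : ℝ) / ℓ = -(1 / ℓ) := neg_div _ _
  have hmain := rpow_div_heightK_le_NprimeK hα hd hℓ hdℓ hX
  have htwo : (1 / 2 : ℝ) ≤ 2 ^ (-(1 / (ℓ : ℝ))) := by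
    rw [Real.rpow_neg two_pos.le, one_div]
    refine inv_anti₀ (by positivity) ?_
    simpa using Real.rpow_le_rpow_of_exponent_le one_le_two ((div_le_one₀ (by linarith)).2 hℓ1)
  have hcmp : (1 / 2 : ℝ) * etaK K ^ (-(1 / (ℓ : ℝ))) ≤ heightK K α ^ (-(1 / (ℓ : ℝ))) :=
    calc (1 / 2 : ℝ) * etaK K ^ (-(1 / (ℓ : ℝ)))
        ≤ 2 ^ (-(1 / (ℓ : ℝ))) * etaK K ^ (-(1 / (ℓ : ℝ))) := by gcongr
      _ = (2 * etaK K) ^ (-(1 / (ℓ : ℝ))) := (Real.mul_rpow two_pos.le heta.le).symm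
      _ ≤ heightK K α ^ (-(1 / (ℓ : ℝ))) :=
        Real.rpow_le_rpow_of_nonpos hH hlt.le (neg_nonpos.2 (by positivity))
  have hsplit : X ^ (-(1 / (ℓ : ℝ))) * (X / heightK K α) ^ (1 / (ℓ : ℝ)) =
      heightK K α ^ (-(1 / (ℓ : ℝ))) := by
    have := (Real.rpow_pos_of_pos hX (1 / (ℓ : ℝ))).ne'
    rw [Real.div_rpow hX.le hH.le, Real.rpow_neg hX.le, Real.rpow_neg hH.le]
    field_simp
  rw [hneg]
  calc (1 / 16 : ℝ) * etaK K ^ (-(1 / (ℓ : ℝ)))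
      ≤ (1 / 8 : ℝ) * heightK K α ^ (-(1 / (ℓ : ℝ))) := by linarith
    _ = X ^ (-(1 / (ℓ : ℝ))) * ((1 / 8 : ℝ) * (X / heightK K α) ^ (1 / (ℓ : ℝ))) := by
      rw [← hsplit]; ring
    _ ≤ X ^ (-(1 / (ℓ : ℝ))) * (1 + NprimeK K X) := by gcongr
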